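/- Let θ ∈ (0, π/2) and let O, P, Q, R be affinely independent points of ℝ³ such that the angle ∠(O P Q) is at least θ and the distance from R to the plane Π spanned by O, P, Q is at least sin θ · dist(O, R). Let A lie in the open segment (O, P), B in the open segment (P, Q), and D in the open segment (O, R). Then ∠(D A B) ≥ φ₀, where φ₀ is the unique φ ∈ (0, π/2) satisfying 2·(1 + 1/sin θ)·sin φ = θ. In particular ∠(D A B) ≥ φ_min for a constant φ_min > 0 depending only on θ. -/

import Mathlib

open Real EuclideanGeometry

/-- The exterior angle of a triangle is at least an opposite interior angle. -/
lemma aux_exterior (O P Q A B : EuclideanSpace ℝ (Fin 3)) (hOP : O ≠ P)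
    (hA : A ∈ openSegment ℝ O P) (hB : B ∈ openSegment ℝ P Q) :
    ∠ O P Q ≤ ∠ O A B := by
  obtain ⟨a, b, ha, hb, hab, rfl⟩ := hA
  obtain ⟨c, d, hc, hd, hcd, rfl⟩ := hB
  set A := a • O + b • P with hAdef
  set B := c • P + d • Q with hBdef
  have hb1 : b = 1 - a := by linarith
  have hc1 : c = 1 - d := by linarith
  have h1 : A - P = a • (O - P) := by rw [hAdef, hb1]; module
  have h2 : B - P = d • (Q - P) := by rw [hBdef, hc1]; module
  have h3 : O - A = b • (O - P) := by
    rw [hAdef, show a = 1 - b by linarith]; module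
  have h4 : P - A = (-a) • (O - P) := by rw [hAdef, hb1]; module
  have hPA : P ≠ A := by
    intro h
    have : (-a) • (O - P) = 0 := by rw [← h4, ← h, sub_self]
    rcases smul_eq_zero.1 this with h | h
    · linarith
    · exact hOP (sub_eq_zero.1 h)
  have e1 : ∠ A P B = ∠ O P Q := by
    simp only [EuclideanGeometry.angle, vsub_eq_sub]
    rw [h1, h2, InnerProductGeometry.angle_smul_left_of_pos _ _ ha,
      InnerProductGeometry.angle_smul_right_of_pos _ _ hd]
  have e2 : ∠ O A B = InnerProductGeometry.angle (O - P) (B - A) := by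
    simp only [EuclideanGeometry.angle, vsub_eq_sub]
    rw [h3, InnerProductGeometry.angle_smul_left_of_pos _ _ hb]
  have e3 : ∠ B A P = π - InnerProductGeometry.angle (O - P) (B - A) := by
    rw [EuclideanGeometry.angle_comm]
    simp only [EuclideanGeometry.angle, vsub_eq_sub]
    rw [h4, InnerProductGeometry.angle_smul_left_of_neg _ _ (by linarith),
      InnerProductGeometry.angle_neg_left]
  have h := EuclideanGeometry.angle_add_angle_add_angle_eq_pi B hPA
  have := EuclideanGeometry.angle_nonneg P B A
  linarith

/-- Some point of the line `AB` is at distance `dist A D * sin ∠DAB` from `D`. -/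
lemma aux_foot (A B D : EuclideanSpace ℝ (Fin 3)) (hBA : B ≠ A) :
    ∃ t : ℝ, dist D (AffineMap.lineMap A B t) = dist A D * Real.sin (∠ D A B) := by
  have hy : 0 < ‖B - A‖ := norm_pos_iff.2 (sub_ne_zero.2 hBA)
  have hin := InnerProductGeometry.cos_angle_mul_norm_mul_norm (D - A) (B - A)
  have hs : 0 ≤ Real.sin (∠ D A B) := InnerProductGeometry.sin_angle_nonneg _ _
  have hdef : ∠ D A B = InnerProductGeometry.angle (D - A) (B - A) := rfl
  rw [← hdef] at hin
  refine ⟨‖D - A‖ * Real.cos (∠ D A B) / ‖B - A‖, ?_⟩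
  set t := ‖D - A‖ * Real.cos (∠ D A B) / ‖B - A‖ with ht
  have ht' : t * ‖B - A‖ = ‖D - A‖ * Real.cos (∠ D A B) := by
    rw [ht]; field_simp
  have hv : D - AffineMap.lineMap A B t = (D - A) - t • (B - A) := by
    rw [AffineMap.lineMap_apply]; simp only [vsub_eq_sub, vadd_eq_add]; abel
  rw [dist_eq_norm, hv, dist_comm A D, dist_eq_norm]
  refine (sq_eq_sq₀ (norm_nonneg _) (by positivity)).1 ?_
  rw [norm_sub_sq_real, inner_smul_right, ← hin, norm_smul, Real.norm_eq_abs, mul_pow, sq_abs]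
  have hsc := Real.sin_sq_add_cos_sq (∠ D A B)
  generalize Real.sin (∠ D A B) = s at *
  generalize Real.cos (∠ D A B) = c at *
  clear_value t
  generalize ‖D - A‖ = x at *
  generalize ‖B - A‖ = y at *
  linear_combination (t * y - c * x) * ht' - x ^ 2 * hsc

/-- Scaling the distance estimate from `R` down to `D`. -/
lemma aux_height (k : ℝ) (O R D X : EuclideanSpace ℝ (Fin 3))
    (S : AffineSubspace ℝ (EuclideanSpace ℝ (Fin 3))) (hO : O ∈ S) (hX : X ∈ S)
    (h : k * dist O R ≤ Metric.infDist R (S : Set (EuclideanSpace ℝ (Fin 3))))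
    (hD : D ∈ openSegment ℝ O R) : k * dist O D ≤ dist D X := by
  obtain ⟨a, b, ha, hb, hab, rfl⟩ := hD
  have ha1 : a = 1 - b := by linarith
  subst ha1
  have hY : AffineMap.lineMap O X b⁻¹ ∈ S := AffineMap.lineMap_mem _ hO hX
  have h1 := h.trans (Metric.infDist_le_dist_of_mem hY)
  have e1 : dist O ((1 - b) • O + b • R) = b * dist O R := by
    rw [dist_eq_norm, dist_eq_norm, show O - ((1 - b) • O + b • R) = b • (O - R) by module,
      norm_smul, Real.norm_of_nonneg hb.le]
  have e2 : dist ((1 - b) • O + b • R) X = b * dist R (AffineMap.lineMap O X b⁻¹) := by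
    rw [dist_eq_norm, dist_eq_norm, ← Real.norm_of_nonneg hb.le, ← norm_smul,
      Real.norm_of_nonneg hb.le, AffineMap.lineMap_apply]
    congr 1
    simp only [vsub_eq_sub, vadd_eq_add, smul_sub, smul_add, smul_smul, mul_inv_cancel₀ hb.ne']
    module
  rw [e1, e2]
  nlinarith

theorem min_angle_quadrilateral_cross_section (θ : ℝ) (hθ : θ ∈ Set.Ioo 0 (π / 2))
    (O P Q R : EuclideanSpace ℝ (Fin 3))
    (hOPQR : AffineIndependent ℝ ![O, P, Q, R])
    (hangle : θ ≤ ∠ O P Q)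
    (hdist : Real.sin θ * dist O R ≤
      Metric.infDist R (affineSpan ℝ ({O, P, Q} : Set (EuclideanSpace ℝ (Fin 3))) :
        Set (EuclideanSpace ℝ (Fin 3))))
    (A B D : EuclideanSpace ℝ (Fin 3))
    (hA : A ∈ openSegment ℝ O P)
    (hB : B ∈ openSegment ℝ P Q)
    (hD : D ∈ openSegment ℝ O R) :
    ∀ φ₀ ∈ Set.Ioo 0 (π / 2),
      2 * (1 + 1 / Real.sin θ) * Real.sin φ₀ = θ →
      φ₀ ≤ ∠ D A B := by
  intro φ hφ heq
  obtain ⟨hθ0, hθ1⟩ := hθ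
  obtain ⟨hφ0, hφ1⟩ := hφ
  have hOP : O ≠ P := fun h => by
    have := hOPQR.injective.ne (show (0 : Fin 4) ≠ 1 by decide)
    exact this (by simpa using h)
  by_contra! hlt
  have hBA : B ≠ A := by
    rintro rfl
    rw [EuclideanGeometry.angle_self_right] at hlt
    linarith
  have hDA : D ≠ A := by
    rintro rfl
    rw [EuclideanGeometry.angle_self_left] at hlt
    linarith
  have hr : 0 < dist A D := dist_pos.2 hDA.symm
  set S := affineSpan ℝ ({O, P, Q} : Set (EuclideanSpace ℝ (Fin 3))) with hS
  have hOS : O ∈ S := mem_affineSpan ℝ (by simp)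
  have hPS : P ∈ S := mem_affineSpan ℝ (by simp)
  have hQS : Q ∈ S := mem_affineSpan ℝ (by simp)
  have hAS : A ∈ S := S.convex.openSegment_subset hOS hPS hA
  have hBS : B ∈ S := S.convex.openSegment_subset hPS hQS hB
  obtain ⟨t, ht⟩ := aux_foot A B D hBA
  have hX := aux_height _ O R D _ S hOS (AffineMap.lineMap_mem t hAS hBS) hdist hD
  rw [ht] at hX
  have hsθ : 0 < Real.sin θ := Real.sin_pos_of_pos_of_lt_pi hθ0 (by linarith [Real.pi_pos])
  have hα0 : 0 ≤ ∠ D A B := EuclideanGeometry.angle_nonneg D A B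
  have hsα : Real.sin (∠ D A B) < Real.sin φ :=
    Real.sin_lt_sin_of_lt_of_le_pi_div_two (by linarith) hφ1.le hlt
  have hsα0 : 0 ≤ Real.sin (∠ D A B) := InnerProductGeometry.sin_angle_nonneg _ _
  set s := Real.sin (∠ D A B) with hs
  set q := s / Real.sin θ with hq
  have hOD : dist O D ≤ q * dist A D := by
    rw [hq, div_mul_eq_mul_div, le_div_iff₀ hsθ]; linarith
  have hsum : 2 * (s + q) < θ := by
    rw [← heq, hq]
    have : 2 * (s + s / Real.sin θ) = 2 * (1 + 1 / Real.sin θ) * s := by ring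
    rw [this]
    exact mul_lt_mul_of_pos_left hsα (by positivity)
  have hq1 : q < 1 := by linarith [Real.pi_lt_four]
  have hODlt : dist O D < dist A D := by nlinarith
  -- the angle OAD is acute
  set β := ∠ O A D with hβ
  have hβ0 : 0 ≤ β := EuclideanGeometry.angle_nonneg O A D
  have hβ1 : β ≤ π / 2 := by
    by_contra! hgt
    have hc : Real.cos β ≤ 0 := Real.cos_nonpos_of_pi_div_two_le_of_le hgt.le
      (by linarith [EuclideanGeometry.angle_le_pi O A D, Real.pi_pos])
    have hl := EuclideanGeometry.law_cos O A D
    rw [← hβ, dist_comm D A] at hl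
    have : dist O A * dist A D * Real.cos β ≤ 0 :=
      mul_nonpos_of_nonneg_of_nonpos (by positivity) hc
    nlinarith [dist_nonneg (x := O) (y := D), dist_nonneg (x := O) (y := A)]
  have hsβ : Real.sin β ≤ q := by
    have hl := EuclideanGeometry.law_sin O A D
    rw [← hβ, dist_comm D O] at hl
    have : Real.sin β * dist A D ≤ q * dist A D := by
      rw [hl]
      exact (mul_le_of_le_one_left dist_nonneg (Real.sin_le_one _)).trans hOD
    exact le_of_mul_le_mul_right this hr
  have j1 := Real.mul_le_sin hβ0 hβ1
  have j2 := Real.mul_le_sin hα0 (hlt.le.trans hφ1.le)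
  have half : (1 : ℝ) / 2 ≤ 2 / π := by
    rw [div_le_div_iff₀ two_pos Real.pi_pos]; linarith [Real.pi_lt_four]
  have k1 : 1 / 2 * β ≤ Real.sin β := (mul_le_mul_of_nonneg_right half hβ0).trans j1
  have k2 : 1 / 2 * ∠ D A B ≤ s := (mul_le_mul_of_nonneg_right half hα0).trans j2
  have tri := EuclideanGeometry.angle_le_angle_add_angle A O D B
  have ext := aux_exterior O P Q A B hOP hA hB
  linarith
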